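/- Let n ≥ 1 and let A be an elasticity Z-tensor. Then A is an elasticity M-tensor if and only if A is M-positive semidefinite, i.e. if and only if A x² y² ≥ 0 for all x, y ∈ ℝ^n. -/

import Mathlib

open Finset

noncomputable section

/-- Symmetry condition of an elasticity tensor: `a_{ijkl} = a_{jikl} = a_{ijlk}`. -/
def ElastSym {n : ℕ} (A : Fin n → Fin n → Fin n → Fin n → ℝ) : Prop :=
  ∀ i j k l, A i j k l = A j i k l ∧ A i j k l = A i j l k

/-- The scalar `A x² y² = ∑ a_{ijkl} x_i x_j y_k y_l`. -/
def tQuad {n : ℕ} (A : Fin n → Fin n → Fin n → Fin n → ℝ) (x y : Fin n → ℝ) : ℝ :=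
  ∑ i, ∑ j, ∑ k, ∑ l, A i j k l * x i * x j * y k * y l

/-- The vector `(A x y²)_i = ∑ a_{ijkl} x_j y_k y_l`. -/
def tAxyy {n : ℕ} (A : Fin n → Fin n → Fin n → Fin n → ℝ) (x y : Fin n → ℝ) : Fin n → ℝ :=
  fun i => ∑ j, ∑ k, ∑ l, A i j k l * x j * y k * y l

/-- The vector `(A x² y)_l = ∑ a_{ijkl} x_i x_j y_k`. -/
def tAxxy {n : ℕ} (A : Fin n → Fin n → Fin n → Fin n → ℝ) (x y : Fin n → ℝ) : Fin n → ℝ :=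
  fun l => ∑ i, ∑ j, ∑ k, A i j k l * x i * x j * y k

/-- The matrix `(A x²)_{kl} = ∑ a_{ijkl} x_i x_j`. -/
def matAx2 {n : ℕ} (A : Fin n → Fin n → Fin n → Fin n → ℝ) (x : Fin n → ℝ) :
    Matrix (Fin n) (Fin n) ℝ :=
  Matrix.of fun k l => ∑ i, ∑ j, A i j k l * x i * x j

/-- The matrix `(A y²)_{ij} = ∑ a_{ijkl} y_k y_l`. -/
def matAy2 {n : ℕ} (A : Fin n → Fin n → Fin n → Fin n → ℝ) (y : Fin n → ℝ) :
    Matrix (Fin n) (Fin n) ℝ :=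
  Matrix.of fun i j => ∑ k, ∑ l, A i j k l * y k * y l

/-- The identity tensor `e_{ijkl} = 1` iff `i = j` and `k = l`. -/
def idT (n : ℕ) : Fin n → Fin n → Fin n → Fin n → ℝ :=
  fun i j k l => if i = j ∧ k = l then 1 else 0

/-- `xᵀ x = 1`. -/
def unitVec {n : ℕ} (x : Fin n → ℝ) : Prop := ∑ i, x i * x i = 1

/-- `(λ, x, y)` is an M-eigenpair of `A`. -/
def IsMEig {n : ℕ} (A : Fin n → Fin n → Fin n → Fin n → ℝ) (lam : ℝ) (x y : Fin n → ℝ) :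
    Prop :=
  (∀ i, tAxyy A x y i = lam * x i) ∧ (∀ l, tAxxy A x y l = lam * y l) ∧
    unitVec x ∧ unitVec y

/-- M-positive definiteness (the strong ellipticity condition). -/
def MPD {n : ℕ} (A : Fin n → Fin n → Fin n → Fin n → ℝ) : Prop :=
  ∀ x y : Fin n → ℝ, x ≠ 0 → y ≠ 0 → 0 < tQuad A x y

/-- M-positive semidefiniteness. -/
def MPSD {n : ℕ} (A : Fin n → Fin n → Fin n → Fin n → ℝ) : Prop :=
  ∀ x y : Fin n → ℝ, 0 ≤ tQuad A x y

/-- All entries are nonnegative. -/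
def NonnegT {n : ℕ} (A : Fin n → Fin n → Fin n → Fin n → ℝ) : Prop :=
  ∀ i j k l, 0 ≤ A i j k l

/-- The M-spectral radius of a nonnegative elasticity tensor:
`sup { B x² y² : xᵀx = yᵀy = 1 }`. -/
def rhoM {n : ℕ} (B : Fin n → Fin n → Fin n → Fin n → ℝ) : ℝ :=
  sSup { r : ℝ | ∃ x y : Fin n → ℝ, unitVec x ∧ unitVec y ∧ r = tQuad B x y }

/-- An elasticity Z-tensor: all off-diagonal entries nonpositive. -/
def ZTensor {n : ℕ} (A : Fin n → Fin n → Fin n → Fin n → ℝ) : Prop :=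
  ∀ i j k l, ¬(i = j ∧ k = l) → A i j k l ≤ 0

/-- A nonsingular elasticity M-tensor: `A = s E - B` with `B` nonnegative and `s > ρ_M(B)`. -/
def NonsingMT {n : ℕ} (A : Fin n → Fin n → Fin n → Fin n → ℝ) : Prop :=
  ∃ (s : ℝ) (B : Fin n → Fin n → Fin n → Fin n → ℝ),
    ElastSym B ∧ NonnegT B ∧ (∀ i j k l, A i j k l = s * idT n i j k l - B i j k l) ∧
      rhoM B < s

/-- An elasticity M-tensor: `A = s E - B` with `B` nonnegative and `s ≥ ρ_M(B)`. -/
def ElastMT {n : ℕ} (A : Fin n → Fin n → Fin n → Fin n → ℝ) : Prop :=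
  ∃ (s : ℝ) (B : Fin n → Fin n → Fin n → Fin n → ℝ),
    ElastSym B ∧ NonnegT B ∧ (∀ i j k l, A i j k l = s * idT n i j k l - B i j k l) ∧
      rhoM B ≤ s

/-- Irreducibility of a (nonnegative) square matrix. -/
def MatIrred {n : ℕ} (M : Matrix (Fin n) (Fin n) ℝ) : Prop :=
  ∀ S : Finset (Fin n), S.Nonempty → S ≠ Finset.univ → ∃ k ∈ S, ∃ l ∉ S, M k l ≠ 0

/-- Strict diagonal dominance. -/
def SDD {n : ℕ} (M : Matrix (Fin n) (Fin n) ℝ) : Prop :=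
  ∀ i, ∑ j ∈ Finset.univ.erase i, |M i j| < |M i i|

theorem tQuad_sub_idT {n : ℕ} {A B : Fin n → Fin n → Fin n → Fin n → ℝ} {s : ℝ}
    (h : ∀ i j k l, A i j k l = s * idT n i j k l - B i j k l) (x y : Fin n → ℝ) :
    tQuad A x y = s * ((∑ i, x i * x i) * ∑ k, y k * y k) - tQuad B x y := by
  have hE : ∑ i, ∑ j, ∑ k, ∑ l, s * idT n i j k l * x i * x j * y k * y l =
      s * ((∑ i, x i * x i) * ∑ k, y k * y k) := by
    simp only [idT, ite_and, mul_ite, ite_mul, mul_one, mul_zero, zero_mul, Finset.sum_ite_irrel,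
      Finset.sum_ite_eq, Finset.sum_const_zero, Finset.mem_univ, if_true]
    rw [Finset.sum_mul_sum]
    simp only [Finset.mul_sum]
    exact Finset.sum_congr rfl fun i _ => Finset.sum_congr rfl fun k _ => by ring
  rw [← hE]
  simp only [tQuad, h, sub_mul, Finset.sum_sub_distrib]

theorem tQuad_smul {n : ℕ} (A : Fin n → Fin n → Fin n → Fin n → ℝ) (c d : ℝ)
    (x y : Fin n → ℝ) : tQuad A (c • x) (d • y) = c ^ 2 * d ^ 2 * tQuad A x y := by
  simp only [tQuad, Finset.mul_sum, Pi.smul_apply, smul_eq_mul]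
  refine Finset.sum_congr rfl fun i _ => Finset.sum_congr rfl fun j _ =>
    Finset.sum_congr rfl fun k _ => Finset.sum_congr rfl fun l _ => by ring

theorem unitVec.abs_le_one {n : ℕ} {x : Fin n → ℝ} (hx : unitVec x) (i : Fin n) :
    |x i| ≤ 1 := by
  rw [← sq_le_one_iff_abs_le_one, sq, ← hx]
  exact Finset.single_le_sum (f := fun i => x i * x i) (fun i _ => mul_self_nonneg (x i))
    (Finset.mem_univ i)

theorem exists_unitVec_smul {n : ℕ} {x : Fin n → ℝ} (hx : x ≠ 0) :
    ∃ (c : ℝ) (u : Fin n → ℝ), unitVec u ∧ x = c • u := by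
  obtain ⟨i, hi⟩ := Function.ne_iff.mp hx
  have hpos : 0 < ∑ i, x i * x i :=
    Finset.sum_pos' (fun i _ => mul_self_nonneg (x i))
      ⟨i, Finset.mem_univ i, mul_self_pos.mpr hi⟩
  have hr := Real.sqrt_pos.mpr hpos
  have hsq := Real.mul_self_sqrt hpos.le
  set r := √(∑ i, x i * x i)
  refine ⟨r, r⁻¹ • x, ?_, (smul_inv_smul₀ hr.ne' x).symm⟩
  simp only [unitVec, Pi.smul_apply, smul_eq_mul, mul_mul_mul_comm r⁻¹ _ r⁻¹]
  rw [← Finset.mul_sum, ← hsq]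
  field_simp

theorem bddAbove_tQuad_unitVec {n : ℕ} (B : Fin n → Fin n → Fin n → Fin n → ℝ) :
    BddAbove {r : ℝ | ∃ x y : Fin n → ℝ, unitVec x ∧ unitVec y ∧ r = tQuad B x y} := by
  refine ⟨∑ i, ∑ j, ∑ k, ∑ l, |B i j k l|, ?_⟩
  rintro _ ⟨x, y, hx, hy, rfl⟩
  refine Finset.sum_le_sum fun i _ => Finset.sum_le_sum fun j _ =>
    Finset.sum_le_sum fun k _ => Finset.sum_le_sum fun l _ => (le_abs_self _).trans ?_
  simp only [abs_mul]
  refine mul_le_of_le_one_right ?_ (hy.abs_le_one l) |>.trans <|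
    mul_le_of_le_one_right ?_ (hy.abs_le_one k) |>.trans <|
    mul_le_of_le_one_right ?_ (hx.abs_le_one j) |>.trans <|
    mul_le_of_le_one_right ?_ (hx.abs_le_one i)
  all_goals positivity

theorem tQuad_le_rhoM {n : ℕ} (B : Fin n → Fin n → Fin n → Fin n → ℝ) {x y : Fin n → ℝ}
    (hx : unitVec x) (hy : unitVec y) : tQuad B x y ≤ rhoM B :=
  le_csSup (bddAbove_tQuad_unitVec B) ⟨x, y, hx, hy, rfl⟩

theorem exists_unitVec {n : ℕ} (hn : 1 ≤ n) : ∃ x : Fin n → ℝ, unitVec x :=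
  ⟨Pi.single ⟨0, hn⟩ 1, by simp [unitVec, Pi.single_apply]⟩

theorem ElastMT.mpsd {n : ℕ} {A : Fin n → Fin n → Fin n → Fin n → ℝ} (h : ElastMT A) :
    MPSD A := by
  obtain ⟨s, B, -, -, hAB, hs⟩ := h
  intro x y
  by_cases hx : x = 0
  · simp [hx, tQuad]
  by_cases hy : y = 0
  · simp [hy, tQuad]
  obtain ⟨c, u, hu, rfl⟩ := exists_unitVec_smul hx
  obtain ⟨d, v, hv, rfl⟩ := exists_unitVec_smul hy
  rw [tQuad_smul]
  refine mul_nonneg (by positivity) ?_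
  rw [tQuad_sub_idT hAB, hu, hv]
  linarith [tQuad_le_rhoM B hu hv]

theorem MPSD.elastMT {n : ℕ} (hn : 1 ≤ n) {A : Fin n → Fin n → Fin n → Fin n → ℝ}
    (hA : ElastSym A) (hZ : ZTensor A) (h : MPSD A) : ElastMT A := by
  set s : ℝ := ∑ i, ∑ k, |A i i k k| with hs
  have hdiag (i k : Fin n) : A i i k k ≤ s :=
    calc A i i k k ≤ |A i i k k| := le_abs_self _
      _ ≤ ∑ k, |A i i k k| :=
        Finset.single_le_sum (f := fun k => |A i i k k|) (fun _ _ => abs_nonneg _)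
          (Finset.mem_univ k)
      _ ≤ s :=
        Finset.single_le_sum (f := fun i => ∑ k, |A i i k k|)
          (fun _ _ => Finset.sum_nonneg fun _ _ => abs_nonneg _) (Finset.mem_univ i)
  have hAB (i j k l : Fin n) :
      A i j k l = s * idT n i j k l - (s * idT n i j k l - A i j k l) := by ring
  refine ⟨s, fun i j k l => s * idT n i j k l - A i j k l, ?_, ?_, hAB, ?_⟩
  · intro i j k l
    constructor
    · simp only [idT, eq_comm (a := i), (hA i j k l).1]
    · simp only [idT, eq_comm (a := k), (hA i j k l).2]
  · intro i j k l
    by_cases hd : i = j ∧ k = l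
    · obtain ⟨rfl, rfl⟩ := hd
      simpa [idT] using hdiag i k
    · simpa [idT, hd] using hZ i j k l hd
  · obtain ⟨e, he⟩ := exists_unitVec hn
    refine csSup_le ⟨_, e, e, he, he, rfl⟩ ?_
    rintro _ ⟨x, y, hx, hy, rfl⟩
    have hq := tQuad_sub_idT hAB x y
    rw [hx, hy] at hq
    linarith [h x y]

/-- an elasticity Z-tensor is an elasticity M-tensor iff it is
M-positive semidefinite. -/
theorem stmt_14 {n : ℕ} (hn : 1 ≤ n) (A : Fin n → Fin n → Fin n → Fin n → ℝ)
    (hA : ElastSym A) (hZ : ZTensor A) :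
    ElastMT A ↔ MPSD A :=
  ⟨ElastMT.mpsd, MPSD.elastMT hn hA hZ⟩
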